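/- arXiv:2105.08540 — 2 statements merged into one kernel-verified Lean document; each statement's English description precedes it below -/
import Mathlib

section
/- Let G be a finite simple graph, let Ĝ be the Karp digraph of G, and let X be any set of vertices of G. Then X is a vertex cover of G if and only if X̂ = {(v,v') : v ∈ X} is a feedback arc set of Ĝ; moreover, X is a minimum vertex cover of G if and only if X̂ is a minimum feedback arc set of Ĝ. -/
/-- `X` is a feedback arc set of the digraph with arc relation `A`: a set of arcs
whose deletion leaves no directed cycle. -/
def IsFAS {C : Type*} (A : C → C → Prop) (X : Set (C × C)) : Prop :=
  (∀ p ∈ X, A p.1 p.2) ∧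
    ∀ a : C, ¬ Relation.TransGen (fun x y => A x y ∧ (x, y) ∉ X) a a

/-- `X` is a feedback arc set of smallest possible cardinality. -/
def IsMinFAS {C : Type*} (A : C → C → Prop) (X : Set (C × C)) : Prop :=
  IsFAS A X ∧ ∀ Y : Set (C × C), IsFAS A Y → X.ncard ≤ Y.ncard

/-- `X` is a feedback arc set no proper subset of which is a feedback arc set. -/
def IsMinimalFAS {C : Type*} (A : C → C → Prop) (X : Set (C × C)) : Prop :=
  IsFAS A X ∧ ∀ Y : Set (C × C), Y ⊂ X → ¬ IsFAS A Y

/-- `X` is a vertex cover of the simple graph `G`. -/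
def IsVC {C : Type*} (G : SimpleGraph C) (X : Set C) : Prop :=
  ∀ a b : C, G.Adj a b → a ∈ X ∨ b ∈ X

/-- `X` is a vertex cover of `G` of smallest possible cardinality. -/
def IsMinVC {C : Type*} (G : SimpleGraph C) (X : Set C) : Prop :=
  IsVC G X ∧ ∀ Y : Set C, IsVC G Y → X.ncard ≤ Y.ncard

/-- The Karp digraph of a simple graph `G`: vertices `v` (as `Sum.inl v`) and
`v'` (as `Sum.inr v`), an arc `(v, v')` for each vertex `v`, and arcs `(v', w)` and
`(w', v)` for each edge `{v, w}` of `G`. -/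
def karpArc {C : Type*} (G : SimpleGraph C) : (C ⊕ C) → (C ⊕ C) → Prop
  | Sum.inl v, Sum.inr w => v = w
  | Sum.inr v, Sum.inl w => G.Adj v w
  | _, _ => False

/-- The arc set `X̂ = {(v, v') : v ∈ X}` of the Karp digraph corresponding to
a vertex set `X`. -/
def karpArcs {C : Type*} (X : Set C) : Set ((C ⊕ C) × (C ⊕ C)) :=
  {p | ∃ v ∈ X, p = (Sum.inl v, Sum.inr v)}

theorem karp_vc_of_fas {C : Type*} (G : SimpleGraph C) (Y : Set ((C ⊕ C) × (C ⊕ C)))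
    (h : IsFAS (karpArc G) Y) :
    IsVC G ((fun p : (C ⊕ C) × (C ⊕ C) =>
      Sum.elim id (fun _ => Sum.elim id id p.2) p.1) '' Y) := by
  intro a b hab
  by_contra hc
  push Not at hc
  obtain ⟨ha, hb⟩ := hc
  have h1 : (Sum.inl a, Sum.inr a) ∉ Y := fun hm => ha ⟨_, hm, rfl⟩
  have h2 : (Sum.inr a, Sum.inl b) ∉ Y := fun hm => hb ⟨_, hm, rfl⟩
  have h3 : (Sum.inl b, Sum.inr b) ∉ Y := fun hm => hb ⟨_, hm, rfl⟩
  have h4 : (Sum.inr b, Sum.inl a) ∉ Y := fun hm => ha ⟨_, hm, rfl⟩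
  refine h.2 (Sum.inl a) ?_
  refine Relation.TransGen.head (b := Sum.inr a) ⟨rfl, h1⟩ ?_
  refine Relation.TransGen.head (b := Sum.inl b) ⟨hab, h2⟩ ?_
  refine Relation.TransGen.head (b := Sum.inr b) ⟨rfl, h3⟩ ?_
  exact Relation.TransGen.single ⟨hab.symm, h4⟩

theorem karp_image {C : Type*} (X : Set C) :
    ((fun p : (C ⊕ C) × (C ⊕ C) =>
      Sum.elim id (fun _ => Sum.elim id id p.2) p.1) '' karpArcs X) = X := by
  ext v
  constructor
  · rintro ⟨_, ⟨w, hw, rfl⟩, rfl⟩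
    exact hw
  · intro hv
    exact ⟨_, ⟨v, hv, rfl⟩, rfl⟩

theorem karp_ncard {C : Type*} (X : Set C) : (karpArcs X).ncard = X.ncard := by
  have : karpArcs X = (fun v : C => ((Sum.inl v, Sum.inr v) : (C ⊕ C) × (C ⊕ C))) '' X := by
    ext p
    constructor
    · rintro ⟨w, hw, rfl⟩
      exact ⟨w, hw, rfl⟩
    · rintro ⟨w, hw, rfl⟩
      exact ⟨w, hw, rfl⟩
  rw [this]
  apply Set.ncard_image_of_injective
  intro a b hab
  simpa using hab

open Classical in
theorem karp_fas_of_vc {C : Type*} (G : SimpleGraph C) (X : Set C) (h : IsVC G X) :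
    IsFAS (karpArc G) (karpArcs X) := by
  constructor
  · rintro _ ⟨v, _, rfl⟩
    rfl
  · let r : C ⊕ C → ℕ := Sum.elim (fun v => if v ∈ X then 0 else 2) (fun v => if v ∈ X then 3 else 1)
    have key : ∀ x y, (karpArc G x y ∧ (x, y) ∉ karpArcs X) → r y < r x := by
      rintro (v | v) (w | w) ⟨h1, h2⟩
      · exact h1.elim
      · have h1 : v = w := h1
        subst h1
        have : v ∉ X := fun hv => h2 ⟨v, hv, rfl⟩
        simp [r, this]
      · have := h v w h1
        by_cases hv : v ∈ X <;> by_cases hw : w ∈ X <;> simp_all [r]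
      · exact h1.elim
    have key2 : ∀ x y, Relation.TransGen
        (fun x y => karpArc G x y ∧ (x, y) ∉ karpArcs X) x y → r y < r x := by
      intro x y hxy
      induction hxy with
      | single h => exact key _ _ h
      | tail _ h ih => exact (key _ _ h).trans ih
    intro a ha
    exact lt_irrefl _ (key2 a a ha)

/-- Karp's reduction: `X` is a (minimum) vertex cover of `G` iff
`X̂ = {(v,v') : v ∈ X}` is a (minimum) feedback arc set of the Karp digraph of `G`. -/
theorem vc_iff_fas_karp {C : Type*} [Fintype C] (G : SimpleGraph C) (X : Set C) :
    (IsVC G X ↔ IsFAS (karpArc G) (karpArcs X)) ∧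
    (IsMinVC G X ↔ IsMinFAS (karpArc G) (karpArcs X)) := by
  have key : ∀ Z : Set C, IsVC G Z ↔ IsFAS (karpArc G) (karpArcs Z) := by
    intro Z
    refine ⟨karp_fas_of_vc G Z, fun h => ?_⟩
    have := karp_vc_of_fas G _ h
    rwa [karp_image] at this
  refine ⟨key X, ?_⟩
  constructor
  · rintro ⟨h1, h2⟩
    refine ⟨(key X).1 h1, fun Y hY => ?_⟩
    rw [karp_ncard]
    exact (h2 _ (karp_vc_of_fas G Y hY)).trans (Set.ncard_image_le Y.toFinite)
  · rintro ⟨h1, h2⟩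
    refine ⟨(key X).2 h1, fun Z hZ => ?_⟩
    have := h2 _ ((key Z).1 hZ)
    rwa [karp_ncard, karp_ncard] at this
end

section
/- Let G be a finite simple graph, k a natural number, and X a minimal vertex cover of G; let Ĝ be the Karp digraph of G and X̂ = {(v,v') : v ∈ X}. Then X̂ is a minimal feedback arc set of Ĝ, and: there exists a set W of at most k vertices of G such that X ∖ W is a minimum vertex cover of G − W, if and only if there exists a set W' of at most k vertices of Ĝ such that X̂ ∩ (arcs of Ĝ − W') is a minimum feedback arc set of Ĝ − W'. -/
/-- `X` is a vertex cover of `G` no proper subset of which is a vertex cover. -/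
def IsMinimalVC {C : Type*} (G : SimpleGraph C) (X : Set C) : Prop :=
  IsVC G X ∧ ∀ Y : Set C, Y ⊂ X → ¬ IsVC G Y

/-- The arc relation of the induced subdigraph of `A` on the vertex set `S`. -/
def ArcsOn {C : Type*} (A : C → C → Prop) (S : Set C) : C → C → Prop :=
  fun a b => A a b ∧ a ∈ S ∧ b ∈ S

/-- `X` is a vertex cover of the induced subgraph of `G` on the vertex set `S`. -/
def IsVCOn {C : Type*} (G : SimpleGraph C) (S X : Set C) : Prop :=
  X ⊆ S ∧ ∀ a ∈ S, ∀ b ∈ S, G.Adj a b → a ∈ X ∨ b ∈ X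

/-- `X` is a minimum vertex cover of the induced subgraph of `G` on the vertex set `S`. -/
def IsMinVCOn {C : Type*} (G : SimpleGraph C) (S X : Set C) : Prop :=
  IsVCOn G S X ∧ ∀ Y : Set C, IsVCOn G S Y → X.ncard ≤ Y.ncard

/-- The projection to `G` of a set of vertices of the Karp digraph. -/
def kproj {C : Type*} (W' : Set (C ⊕ C)) : Set C := {v | Sum.inl v ∈ W' ∨ Sum.inr v ∈ W'}

/-- The underlying vertex of a vertex of the Karp digraph. -/
def kun {C : Type*} : C ⊕ C → C := Sum.elim id id

lemma kproj_eq {C : Type*} (W' : Set (C ⊕ C)) : kproj W' = kun '' W' := by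
  ext v
  simp [kproj, kun]

lemma karpArcs_eq {C : Type*} (Y : Set C) :
    karpArcs Y = (fun v => (Sum.inl v, Sum.inr v)) '' Y := by
  ext p
  simp [karpArcs, eq_comm]

lemma ncard_karpArcs {C : Type*} (Y : Set C) : (karpArcs Y).ncard = Y.ncard := by
  rw [karpArcs_eq]
  apply Set.ncard_image_of_injective
  intro a b h
  simpa using h

lemma fas_of_vc {C : Type*} (G : SimpleGraph C) (W' : Set (C ⊕ C)) (Y : Set C)
    (h : IsVCOn G (kproj W')ᶜ Y) : IsFAS (ArcsOn (karpArc G) W'ᶜ) (karpArcs Y) := by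
  classical
  obtain ⟨h1, h2⟩ := h
  constructor
  · rintro p ⟨v, hv, rfl⟩
    have := h1 hv
    simp only [kproj, Set.mem_compl_iff, Set.mem_ofPred_eq, not_or] at this
    exact ⟨rfl, this.1, this.2⟩
  · intro a ha
    let T : Set C := (kproj W')ᶜ \ Y
    let r : C ⊕ C → ℕ := Sum.elim (fun v => if v ∈ T then 1 else 3) (fun v => if v ∈ T then 2 else 0)
    have key : ∀ x y, (ArcsOn (karpArc G) W'ᶜ x y ∧ (x, y) ∉ karpArcs Y) → r x < r y := by
      rintro (v | v) (w | w) ⟨⟨ha, hx, hy⟩, hn⟩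
      · exact ha.elim
      · have e : v = w := ha
        subst e
        have hT : v ∈ T := by
          refine ⟨?_, fun hv => hn ⟨v, hv, rfl⟩⟩
          rintro (h | h)
          · exact hx h
          · exact hy h
        simp [r, hT]
      · have e : G.Adj v w := ha
        by_cases hv : v ∈ T <;> by_cases hw : w ∈ T
        · exfalso
          rcases h2 v hv.1 w hw.1 e with h | h
          · exact hv.2 h
          · exact hw.2 h
        all_goals simp [r, hv, hw]
      · exact ha.elim
    have := Relation.TransGen.lift (p := fun m n : ℕ => m < n) r key _ _ ha
    rw [Relation.transGen_eq_self] at this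
    exact lt_irrefl _ this

lemma vc_of_fas {C : Type*} (G : SimpleGraph C) (W' : Set (C ⊕ C)) (Z : Set ((C ⊕ C) × (C ⊕ C)))
    (h : IsFAS (ArcsOn (karpArc G) W'ᶜ) Z) :
    IsVCOn G (kproj W')ᶜ ((fun p => kun p.2) '' Z ∩ (kproj W')ᶜ) := by
  refine ⟨Set.inter_subset_right, ?_⟩
  intro a ha b hb hab
  by_contra hc
  rw [not_or] at hc
  obtain ⟨hca, hcb⟩ := hc
  have na : ∀ x y, kun y = a → (x, y) ∉ Z := fun x y hy hz => hca ⟨⟨_, hz, hy⟩, ha⟩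
  have nb : ∀ x y, kun y = b → (x, y) ∉ Z := fun x y hy hz => hcb ⟨⟨_, hz, hy⟩, hb⟩
  simp only [kproj, Set.mem_compl_iff, Set.mem_ofPred_eq, not_or] at ha hb
  refine h.2 (Sum.inl a) (.tail (b := Sum.inr b) (.tail (b := Sum.inl b)
    (.tail (b := Sum.inr a) (.single ?_) ?_) ?_) ?_)
  · exact ⟨⟨rfl, ha.1, ha.2⟩, na _ _ rfl⟩
  · exact ⟨⟨hab, ha.2, hb.1⟩, nb _ _ rfl⟩
  · exact ⟨⟨rfl, hb.1, hb.2⟩, nb _ _ rfl⟩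
  · exact ⟨⟨hab.symm, hb.2, ha.1⟩, na _ _ rfl⟩

lemma kun_karpArcs {C : Type*} (Y : Set C) : (fun p => kun p.2) '' karpArcs Y = Y := by
  rw [karpArcs_eq, Set.image_image]
  simp [kun]

lemma min_iff {C : Type*} [Fintype C] (G : SimpleGraph C) (W' : Set (C ⊕ C)) (X : Set C) :
    IsMinFAS (ArcsOn (karpArc G) W'ᶜ) (karpArcs X ∩ {p | ArcsOn (karpArc G) W'ᶜ p.1 p.2}) ↔
      IsMinVCOn G (kproj W')ᶜ (X \ kproj W') := by
  have e : karpArcs X ∩ {p | ArcsOn (karpArc G) W'ᶜ p.1 p.2} = karpArcs (X \ kproj W') := by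
    ext p
    constructor
    · rintro ⟨⟨v, hv, rfl⟩, -, h1, h2⟩
      refine ⟨v, ⟨hv, ?_⟩, rfl⟩
      rintro (h | h)
      · exact h1 h
      · exact h2 h
    · rintro ⟨v, ⟨hv, hw⟩, rfl⟩
      exact ⟨⟨v, hv, rfl⟩, rfl, fun h => hw (Or.inl h), fun h => hw (Or.inr h)⟩
  rw [e]
  constructor
  · rintro ⟨h1, h2⟩
    refine ⟨?_, fun Y hY => ?_⟩
    · have := vc_of_fas G W' _ h1
      rwa [kun_karpArcs, Set.inter_eq_left.2 (fun x hx => hx.2)] at this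
    · have := h2 _ (fas_of_vc G W' Y hY)
      rwa [ncard_karpArcs, ncard_karpArcs] at this
  · rintro ⟨h1, h2⟩
    refine ⟨fas_of_vc G W' _ h1, fun Z hZ => ?_⟩
    rw [ncard_karpArcs]
    exact (h2 _ (vc_of_fas G W' Z hZ)).trans ((Set.ncard_le_ncard Set.inter_subset_left
      (Set.toFinite _)).trans (Set.ncard_image_le (Set.toFinite _)))

/-- Correctness of the reduction from Minimum Vertex Cover Recognition Restriction to
Minimum FAS Recognition Restriction: for `X` a minimal vertex cover of `G`, the arc set
`X̂ = {(v,v') : v ∈ X}` is a minimal feedback arc set of the Karp digraph `Ĝ`, and one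
can delete at most `k` vertices `W` of `G` so that `X ∖ W` is a minimum vertex cover of
`G − W` iff one can delete at most `k` vertices `W'` of `Ĝ` so that the part of `X̂`
remaining in `Ĝ − W'` is a minimum feedback arc set of `Ĝ − W'`. -/
theorem vc_recognition_restriction_iff_fas_recognition_restriction
    {C : Type*} [Fintype C] (G : SimpleGraph C) (k : ℕ) (X : Set C)
    (hX : IsMinimalVC G X) :
    IsMinimalFAS (karpArc G) (karpArcs X) ∧
    ((∃ W : Set C, W.ncard ≤ k ∧ IsMinVCOn G Wᶜ (X \ W)) ↔
      (∃ W' : Set (C ⊕ C), W'.ncard ≤ k ∧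
        IsMinFAS (ArcsOn (karpArc G) W'ᶜ)
          (karpArcs X ∩ {p | ArcsOn (karpArc G) W'ᶜ p.1 p.2}))) := by
  refine ⟨?_, ?_, ?_⟩
  · have e : ArcsOn (karpArc G) (∅ : Set (C ⊕ C))ᶜ = karpArc G := by
      funext a b
      simp [ArcsOn]
    have e2 : kproj (∅ : Set (C ⊕ C)) = ∅ := by
      simp [kproj]
    constructor
    · rw [← e]
      apply fas_of_vc
      rw [e2]
      exact ⟨by simp, fun a _ b _ hab => hX.1 a b hab⟩
    · intro Y hY hF
      rw [← e] at hF
      have h := vc_of_fas G ∅ Y hF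
      rw [e2, Set.compl_empty, Set.inter_univ] at h
      refine hX.2 _ ?_ (fun a b hab => h.2 a trivial b trivial hab)
      refine ⟨?_, fun hs => hY.2 ?_⟩
      · rw [← kun_karpArcs X]
        exact Set.image_mono hY.1
      · rintro p ⟨v, hv, rfl⟩
        obtain ⟨q, hq, hqv⟩ := hs hv
        obtain ⟨w, hw, rfl⟩ := hY.1 hq
        have e3 : w = v := hqv
        rwa [← e3]
  · rintro ⟨W, hW, hm⟩
    refine ⟨Sum.inl '' W, ?_, ?_⟩
    · rwa [Set.ncard_image_of_injective _ Sum.inl_injective]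
    · rw [min_iff]
      have e : kproj (Sum.inl '' W : Set (C ⊕ C)) = W := by
        ext v
        simp [kproj]
      rwa [e]
  · rintro ⟨W', hW, hm⟩
    refine ⟨kproj W', ?_, (min_iff G W' X).1 hm⟩
    rw [kproj_eq]
    exact (Set.ncard_image_le (Set.toFinite _)).trans hW
end
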